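/- arXiv:0705.1822 — 2 statements merged into one kernel-verified Lean document; each statement's English description precedes it below -/
import Mathlib

section
/- Let T > 0, K ≥ 0, and let δ : [0,T] → [0,∞) be continuous such that φ(s) := s + δ(s) is strictly increasing with φ(T) ≤ T + K, and suppose the inverse function ψ : [φ(0), φ(T)] → [0,T] of φ is continuously differentiable with ψ′(u) ≤ L for all u ∈ [φ(0), φ(T)], where L ≥ 0. Then for every nonnegative Lebesgue-integrable function g on [0, T+K] and every t ∈ [0,T], ∫_t^T g(s+δ(s)) ds ≤ L ∫_t^{T+K} g(s) ds; that is, δ satisfies condition (ii) with constant L. -/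
open MeasureTheory Set

/-- Condition (ii) with constant `L`. -/
def CondII (T K L : ℝ) (δ : ℝ → ℝ) : Prop :=
  ∀ g : ℝ → ℝ, (∀ s, 0 ≤ g s) → IntegrableOn g (Icc 0 (T + K)) →
    ∀ t ∈ Icc (0:ℝ) T, (∫ s in t..T, g (s + δ s)) ≤ L * ∫ s in t..(T + K), g s

/-- **Delays with a `C¹` inverse of slope at most `L` satisfy condition (ii)**
(Remark 4.1, Example 2).  If `φ(s) = s + δ(s)` is strictly increasing on `[0,T]` with
`φ(T) ≤ T + K`, and its inverse `ψ : [φ(0), φ(T)] → [0,T]` is continuously differentiable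
with `ψ′ ≤ L`, then for every nonnegative integrable `g` on `[0, T+K]` and `t ∈ [0,T]`,
`∫_t^T g(s+δ(s)) ds ≤ L ∫_t^{T+K} g(s) ds`. -/
theorem stmt_3 (T K L : ℝ) (hT : 0 < T) (hK : 0 ≤ K) (hL : 0 ≤ L)
    (δ : ℝ → ℝ) (hδc : ContinuousOn δ (Icc 0 T)) (hδ0 : ∀ t ∈ Icc (0:ℝ) T, 0 ≤ δ t)
    (hmono : StrictMonoOn (fun s => s + δ s) (Icc 0 T))
    (hiT : T + δ T ≤ T + K)
    (ψ ψ' : ℝ → ℝ)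
    (hψleft : ∀ s ∈ Icc (0:ℝ) T, ψ (s + δ s) = s)
    (hψright : ∀ u ∈ Icc (0 + δ 0) (T + δ T), ψ u + δ (ψ u) = u)
    (hψmaps : ∀ u ∈ Icc (0 + δ 0) (T + δ T), ψ u ∈ Icc (0:ℝ) T)
    (hderiv : ∀ u ∈ Icc (0 + δ 0) (T + δ T), HasDerivAt ψ (ψ' u) u)
    (hψ'cont : ContinuousOn ψ' (Icc (0 + δ 0) (T + δ T)))
    (hψ'le : ∀ u ∈ Icc (0 + δ 0) (T + δ T), ψ' u ≤ L) :
    CondII T K L δ := by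
  intro g hg hgint t ht
  have h0 : (0 : ℝ) ∈ Icc (0 : ℝ) T := ⟨le_rfl, hT.le⟩
  have hTm : T ∈ Icc (0 : ℝ) T := ⟨hT.le, le_rfl⟩
  have hφ : ∀ {a b}, a ∈ Icc (0 : ℝ) T → b ∈ Icc (0 : ℝ) T → (a + δ a ≤ b + δ b ↔ a ≤ b) :=
    fun ha hb => hmono.le_iff_le ha hb
  have hsub : Icc (t + δ t) (T + δ T) ⊆ Icc (0 + δ 0) (T + δ T) :=
    Icc_subset_Icc_left ((hφ h0 ht).2 ht.1)
  have hψmono : MonotoneOn ψ (Icc (0 + δ 0) (T + δ T)) := fun u hu v hv huv => by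
    rw [← hφ (hψmaps u hu) (hψmaps v hv), hψright u hu, hψright v hv]
    exact huv
  have hlt : 0 + δ 0 < T + δ T := hmono h0 hTm hT
  have hψ'nonneg : ∀ u ∈ Icc (0 + δ 0) (T + δ T), 0 ≤ ψ' u := fun u hu => by
    rw [← (hderiv u hu).hasDerivWithinAt.derivWithin (uniqueDiffOn_Icc hlt u hu)]
    exact hψmono.derivWithin_nonneg
  have himage : ψ '' Icc (t + δ t) (T + δ T) = Icc t T := by
    ext s
    constructor
    · rintro ⟨u, hu, rfl⟩
      have hm := hψmaps u (hsub hu)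
      refine ⟨?_, hm.2⟩
      rw [← hφ ht hm, hψright u (hsub hu)]
      exact hu.1
    · intro hs
      have hm : s ∈ Icc (0 : ℝ) T := ⟨ht.1.trans hs.1, hs.2⟩
      exact ⟨s + δ s, ⟨(hφ ht hm).2 hs.1, (hφ hm hTm).2 hs.2⟩, hψleft s hm⟩
  have hinj : InjOn ψ (Icc (t + δ t) (T + δ T)) := fun u hu v hv huv => by
    rw [← hψright u (hsub hu), ← hψright v (hsub hv), huv]
  have hsub' : Icc (t + δ t) (T + δ T) ⊆ Icc t (T + K) :=
    Icc_subset_Icc (le_add_of_nonneg_right (hδ0 t ht)) hiT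
  have hgt : IntegrableOn g (Icc t (T + K)) := hgint.mono_set (Icc_subset_Icc_left ht.1)
  rw [intervalIntegral.integral_of_le ht.2,
    intervalIntegral.integral_of_le (ht.2.trans (le_add_of_nonneg_right hK)),
    ← integral_Icc_eq_integral_Ioc, ← integral_Icc_eq_integral_Ioc]
  calc ∫ s in Icc t T, g (s + δ s)
      = ∫ u in Icc (t + δ t) (T + δ T), |ψ' u| • g (ψ u + δ (ψ u)) := by
        rw [← himage]
        exact integral_image_eq_integral_abs_deriv_smul measurableSet_Icc
          (fun u hu => (hderiv u (hsub hu)).hasDerivWithinAt) hinj (fun s => g (s + δ s))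
    _ ≤ ∫ u in Icc (t + δ t) (T + δ T), L * g u := by
        refine integral_mono_of_nonneg
          (ae_of_all _ fun u => smul_nonneg (abs_nonneg _) (hg _))
          ((hgt.mono_set hsub').const_mul L) ?_
        filter_upwards [ae_restrict_mem measurableSet_Icc] with u hu
        rw [hψright u (hsub hu), abs_of_nonneg (hψ'nonneg u (hsub hu)), smul_eq_mul]
        exact mul_le_mul_of_nonneg_right (hψ'le u (hsub hu)) (hg u)
    _ = L * ∫ u in Icc (t + δ t) (T + δ T), g u := integral_const_mul _ _
    _ ≤ L * ∫ u in Icc t (T + K), g u :=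
        mul_le_mul_of_nonneg_left
          (setIntegral_mono_set hgt (ae_of_all _ hg) hsub'.eventuallyLE) hL
end

section
/- (Failure of comparison for generators decreasing in the anticipated term, Example 5.2, deterministic form.) Let δ > 0, T ≥ δ, c < 0 and a = −2/δ. Define Y : [T−δ, T+δ] → ℝ by Y_t = c + a·c·(T−t) for t ∈ [T−δ, T] and Y_t = c for t ∈ [T, T+δ]. Then Y satisfies the anticipated equation Y_t = c + ∫_t^T a·Y_{s+δ} ds for every t ∈ [T−δ, T], and Y_t > 0 for every t ∈ [T−δ, T−δ/2); in particular Y_{T−δ} = −c > 0 even though the terminal values Y_s = c are strictly negative for all s ∈ [T, T+δ]. -/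
open Set

/-- **Failure of the comparison theorem for generators decreasing in the anticipated term**
(Example 5.2, deterministic form).  With `δ > 0`, `T ≥ δ`, `c < 0`, `a = −2/δ`, the function
`Y_t = c + a·c·(T−t)` on `[T−δ, T]`, `Y_t = c` on `[T, T+δ]`, satisfies the anticipated
equation `Y_t = c + ∫_t^T a·Y_{s+δ} ds` on `[T−δ, T]`, yet `Y_t > 0` on `[T−δ, T−δ/2)`;
in particular `Y_{T−δ} = −c > 0` although the terminal values `Y_s = c < 0` on `[T, T+δ]`. -/
theorem stmt_14 (δ T c a : ℝ) (hδ : 0 < δ) (hT : δ ≤ T) (hc : c < 0) (ha : a = -2 / δ)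
    (Y : ℝ → ℝ)
    (hY1 : ∀ t ∈ Icc (T - δ) T, Y t = c + a * c * (T - t))
    (hY2 : ∀ t ∈ Icc T (T + δ), Y t = c) :
    (∀ t ∈ Icc (T - δ) T, Y t = c + ∫ s in t..T, a * Y (s + δ)) ∧
    (∀ t ∈ Ico (T - δ) (T - δ / 2), 0 < Y t) ∧
    Y (T - δ) = -c ∧ 0 < -c ∧ (∀ s ∈ Icc T (T + δ), Y s < 0) := by
  have haδ : a * δ = -2 := by rw [ha]; field_simp
  refine ⟨fun t ht => ?_, fun t ht => ?_, ?_, by linarith, fun s hs => by rw [hY2 s hs]; exact hc⟩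
  · have hint : ∫ s in t..T, a * Y (s + δ) = ∫ _ in t..T, a * c := by
      refine intervalIntegral.integral_congr fun s hs => ?_
      rw [uIcc_of_le ht.2] at hs
      have hsδ : s + δ ∈ Icc T (T + δ) := ⟨by linarith [ht.1, hs.1], by linarith [hs.2]⟩
      simp only [hY2 _ hsδ]
    rw [hint, intervalIntegral.integral_const, smul_eq_mul, hY1 t ht]
    ring
  · rw [hY1 t ⟨ht.1, by linarith [ht.2]⟩]
    have ha_neg : a < 0 := by
      rw [ha]
      exact div_neg_of_neg_of_pos (by norm_num) hδ
    have hac : 0 < a * c := mul_pos_of_neg_of_neg ha_neg hc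
    have hlt : a * c * (δ / 2) < a * c * (T - t) :=
      mul_lt_mul_of_pos_left (by linarith [ht.2]) hac
    linear_combination hlt - c / 2 * haδ
  · rw [hY1 _ ⟨le_rfl, by linarith⟩]
    linear_combination c * haδ
end
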